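/- Consider the undirected binary SBM with n ≥ 2 nodes, Q groups, group proportions π with π_q > 0, and symmetric connectivity matrix γ with entries γ_{qℓ} ∈ (0,1), and fix an observed binary symmetric configuration y = (y_{ij})_{1≤i<j≤n}. For a matrix τ = (τ_{iq}) with all τ_{iq} > 0 and ∑_{q=1}^Q τ_{iq} = 1 for each i, let Q_τ be the product distribution on {1,…,Q}^n given by Q_τ(z) = ∏_{i=1}^n τ_{i z_i}. If τ minimizes the Kullback–Leibler divergence KL(Q_τ ‖ P(Z = · | Y = y)) over all such positive product distributions, then τ satisfies the fixed-point relation: for every i and q, τ_{iq} = C_i · π_q ∏_{j≠i} ∏_{ℓ=1}^Q [γ_{qℓ}^{y_{ij}} (1−γ_{qℓ})^{1−y_{ij}}]^{τ_{jℓ}}, where C_i > 0 is the constant making ∑_q τ_{iq} = 1. -/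

import Mathlib

open Finset

/-- Probability of an edge value `b` when the connection probability is `g`. -/
def edgeProb (g : ℝ) (b : Bool) : ℝ := if b then g else 1 - g

/-- Joint pmf of the undirected binary SBM (no self-loops). -/
def sbmJoint (n Q : ℕ) (π : Fin Q → ℝ) (γ : Fin Q → Fin Q → ℝ)
    (z : Fin n → Fin Q) (y : Fin n → Fin n → Bool) : ℝ :=
  (∏ i, π (z i)) *
    ∏ p ∈ Finset.univ.filter (fun p : Fin n × Fin n => p.1 < p.2),
      edgeProb (γ (z p.1) (z p.2)) (y p.1 p.2)

/-- A mean-field expectation of a product of single-site functions factorizes. -/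
theorem sum_prod_mul_prod {ι κ : Type*} [Fintype ι] [DecidableEq ι] [Fintype κ]
    (τ g : ι → κ → ℝ) :
    ∑ z : ι → κ, (∏ k, τ k (z k)) * ∏ k, g k (z k) = ∏ k, ∑ q, τ k q * g k q := by
  simp only [Finset.prod_univ_sum, Fintype.piFinset_univ, Finset.prod_mul_distrib]

theorem sum_prod_eq_one {ι κ : Type*} [Fintype ι] [DecidableEq ι] [Fintype κ]
    {τ : ι → κ → ℝ} (hτ : ∀ i, ∑ q, τ i q = 1) :
    ∑ z : ι → κ, ∏ k, τ k (z k) = 1 := by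
  simpa [hτ] using sum_prod_mul_prod τ (fun _ _ => 1)

/-- Single-site marginals of a product distribution. -/
theorem sum_prod_mul_apply {ι κ : Type*} [Fintype ι] [DecidableEq ι] [Fintype κ]
    {τ : ι → κ → ℝ} (hτ : ∀ i, ∑ q, τ i q = 1) (i : ι) (f : κ → ℝ) :
    ∑ z : ι → κ, (∏ k, τ k (z k)) * f (z i) = ∑ q, τ i q * f q := by
  have h := sum_prod_mul_prod τ (fun k q => if k = i then f q else 1)
  rw [Fintype.prod_eq_single (a := i) (fun k hk => by simp [hk, hτ])] at h
  simpa using h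

/-- Two-site marginals of a product distribution. -/
theorem sum_prod_mul_apply₂ {ι κ : Type*} [Fintype ι] [DecidableEq ι] [Fintype κ]
    [DecidableEq κ] {τ : ι → κ → ℝ} (hτ : ∀ i, ∑ q, τ i q = 1) {i j : ι} (hij : i ≠ j)
    (f : κ → κ → ℝ) :
    ∑ z : ι → κ, (∏ k, τ k (z k)) * f (z i) (z j)
      = ∑ q, τ i q * ∑ l, τ j l * f q l := by
  have key (u v : κ → ℝ) : ∑ z : ι → κ, (∏ k, τ k (z k)) * (u (z i) * v (z j))
      = (∑ q, τ i q * u q) * ∑ l, τ j l * v l := by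
    have h := sum_prod_mul_prod τ
      (fun k q => (if k = i then u q else 1) * (if k = j then v q else 1))
    rw [Fintype.prod_eq_mul i j hij (fun k hk => by simp [hk.1, hk.2, hτ])] at h
    have hz (z : ι → κ) : ∏ k, (if k = i then u (z k) else 1) * (if k = j then v (z k) else 1)
        = u (z i) * v (z j) := by
      rw [Finset.prod_mul_distrib]
      simp
    simp only [hz] at h
    simpa [hij, hij.symm] using h
  have hf (z : ι → κ) : (∏ k, τ k (z k)) * f (z i) (z j)
      = ∑ a, (∏ k, τ k (z k)) * ((if z i = a then 1 else 0) * f a (z j)) := by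
    simp
  simp only [hf]
  rw [Finset.sum_comm]
  refine Finset.sum_congr rfl fun a _ => ?_
  rw [key (fun q => if q = a then 1 else 0) (f a)]
  simp

/-- Isolate the pairs containing `i` in a sum over unordered pairs. -/
theorem sum_lt_eq_sum_erase_add {ι : Type*} [Fintype ι] [LinearOrder ι] (G : ι → ι → ℝ)
    (hG : ∀ a b, G a b = G b a) (i : ι) :
    ∑ p ∈ Finset.univ.filter (fun p : ι × ι => p.1 < p.2), G p.1 p.2
      = ∑ j ∈ Finset.univ.erase i, G i j
        + ∑ p ∈ Finset.univ.filter (fun p : ι × ι => p.1 < p.2 ∧ p.1 ≠ i ∧ p.2 ≠ i),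
            G p.1 p.2 := by
  rw [← Finset.sum_filter_add_sum_filter_not _ (fun p : ι × ι => p.1 = i ∨ p.2 = i)]
  simp only [Finset.filter_filter, not_or]
  congr 1
  refine Finset.sum_bij' (fun p _ => if p.1 = i then p.2 else p.1)
    (fun j _ => if i < j then (i, j) else (j, i)) ?_ ?_ ?_ ?_ ?_
  · rintro ⟨a, b⟩ h
    simp only [Finset.mem_filter, Finset.mem_univ, true_and, Finset.mem_erase, and_true] at h ⊢
    split_ifs with h1
    · exact h1 ▸ h.1.ne'
    · exact h1
  · intro j h
    simp only [Finset.mem_filter, Finset.mem_univ, true_and, Finset.mem_erase, and_true] at h ⊢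
    split_ifs with h1
    · simp [h1]
    · simp [lt_of_le_of_ne (not_lt.1 h1) h]
  · rintro ⟨a, b⟩ h
    simp only [Finset.mem_filter, Finset.mem_univ, true_and] at h
    obtain ⟨hab, rfl | rfl⟩ := h
    · simp [hab]
    · simp [hab.ne, hab.not_gt]
  · intro j h
    simp only [Finset.mem_univ, Finset.mem_erase, and_true] at h
    split_ifs <;> simp_all
  · rintro ⟨a, b⟩ h
    simp only [Finset.mem_filter, Finset.mem_univ, true_and] at h
    obtain ⟨hab, rfl | rfl⟩ := h
    · simp
    · simp [hab.ne, hG a b]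

/-- Equality case of Gibbs' inequality. -/
theorem eq_of_sum_mul_log_sub_le {κ : Type*} [Fintype κ] {p s : κ → ℝ}
    (hp : ∀ q, 0 < p q) (hs : ∀ q, 0 < s q) (hps : ∑ q, p q = ∑ q, s q)
    (h : ∑ q, p q * (Real.log (p q) - Real.log (s q)) ≤ 0) : p = s := by
  have hle (q) : p q - s q ≤ p q * (Real.log (p q) - Real.log (s q)) := by
    have h1 := Real.log_le_sub_one_of_pos (div_pos (hs q) (hp q))
    rw [Real.log_div (hs q).ne' (hp q).ne'] at h1
    have h2 := mul_le_mul_of_nonneg_left h1 (hp q).le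
    rw [mul_sub (p q) (s q / p q), mul_div_cancel₀ _ (hp q).ne'] at h2
    linarith
  have heq := (Finset.sum_eq_sum_iff_of_le (fun q (_ : q ∈ Finset.univ) => hle q)).1
    (le_antisymm (Finset.sum_le_sum fun q _ => hle q)
      (by rw [Finset.sum_sub_distrib, hps, sub_self]; exact h))
  funext q
  by_contra hne
  have h1 := Real.log_lt_sub_one_of_pos (div_pos (hs q) (hp q))
    (fun h => hne ((div_eq_one_iff_eq (hp q).ne').1 h).symm)
  rw [Real.log_div (hs q).ne' (hp q).ne'] at h1
  have h2 := mul_lt_mul_of_pos_left h1 (hp q)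
  rw [mul_sub (p q) (s q / p q), mul_div_cancel₀ _ (hp q).ne'] at h2
  linarith [heq q (Finset.mem_univ q)]

theorem edgeProb_pos {g : ℝ} (hg : g ∈ Set.Ioo (0 : ℝ) 1) (b : Bool) : 0 < edgeProb g b := by
  cases b
  · simpa [edgeProb] using hg.2
  · simpa [edgeProb] using hg.1

theorem sbmJoint_pos {n Q : ℕ} {π : Fin Q → ℝ} (hπ : ∀ q, 0 < π q) {γ : Fin Q → Fin Q → ℝ}
    (hγ : ∀ q l, γ q l ∈ Set.Ioo (0 : ℝ) 1) (z : Fin n → Fin Q) (y : Fin n → Fin n → Bool) :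
    0 < sbmJoint n Q π γ z y :=
  mul_pos (Finset.prod_pos fun _ _ => hπ _)
    (Finset.prod_pos fun _ _ => edgeProb_pos (hγ _ _) _)

theorem log_sbmJoint {n Q : ℕ} {π : Fin Q → ℝ} (hπ : ∀ q, 0 < π q) {γ : Fin Q → Fin Q → ℝ}
    (hγ : ∀ q l, γ q l ∈ Set.Ioo (0 : ℝ) 1) (z : Fin n → Fin Q) (y : Fin n → Fin n → Bool) :
    Real.log (sbmJoint n Q π γ z y) = ∑ i, Real.log (π (z i))
      + ∑ p ∈ Finset.univ.filter (fun p : Fin n × Fin n => p.1 < p.2),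
        Real.log (edgeProb (γ (z p.1) (z p.2)) (y p.1 p.2)) := by
  rw [sbmJoint, Real.log_mul (Finset.prod_pos fun _ _ => hπ _).ne'
      (Finset.prod_pos fun _ _ => edgeProb_pos (hγ _ _) _).ne',
    Real.log_prod fun _ _ => (hπ _).ne',
    Real.log_prod fun _ _ => (edgeProb_pos (hγ _ _) _).ne']

/-- The mean-field Kullback–Leibler divergence in terms of one- and two-site marginals; `N` is
the normalizing constant of the posterior. -/
theorem sum_prod_mul_log_div_sbmJoint {n Q : ℕ} {π : Fin Q → ℝ} (hπ : ∀ q, 0 < π q)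
    {γ : Fin Q → Fin Q → ℝ} (hγ : ∀ q l, γ q l ∈ Set.Ioo (0 : ℝ) 1)
    (y : Fin n → Fin n → Bool) {N : ℝ} (hN : 0 < N) {τ : Fin n → Fin Q → ℝ}
    (hτpos : ∀ i q, 0 < τ i q) (hτsum : ∀ i, ∑ q, τ i q = 1) :
    ∑ z : Fin n → Fin Q, (∏ i, τ i (z i)) *
        Real.log ((∏ i, τ i (z i)) / (sbmJoint n Q π γ z y / N))
      = ∑ i, ∑ q, τ i q * (Real.log (τ i q) - Real.log (π q))
        - ∑ p ∈ Finset.univ.filter (fun p : Fin n × Fin n => p.1 < p.2),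
            ∑ q, τ p.1 q * ∑ l, τ p.2 l * Real.log (edgeProb (γ q l) (y p.1 p.2))
        + Real.log N := by
  have hlog (z : Fin n → Fin Q) :
      Real.log ((∏ i, τ i (z i)) / (sbmJoint n Q π γ z y / N))
        = ∑ i, (Real.log (τ i (z i)) - Real.log (π (z i)))
          - ∑ p ∈ Finset.univ.filter (fun p : Fin n × Fin n => p.1 < p.2),
              Real.log (edgeProb (γ (z p.1) (z p.2)) (y p.1 p.2))
          + Real.log N := by
    have hJ := sbmJoint_pos hπ hγ z y
    rw [Real.log_div (Finset.prod_pos fun _ _ => hτpos _ _).ne' (div_pos hJ hN).ne',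
      Real.log_div hJ.ne' hN.ne', log_sbmJoint hπ hγ,
      Real.log_prod fun _ _ => (hτpos _ _).ne', Finset.sum_sub_distrib]
    ring
  simp only [hlog, mul_add, mul_sub (∏ i, τ i _), Finset.sum_add_distrib]
  rw [Finset.sum_sub_distrib]
  congr 1
  · congr 1
    · simp only [Finset.mul_sum]
      rw [Finset.sum_comm]
      exact Finset.sum_congr rfl fun i _ =>
        sum_prod_mul_apply hτsum i fun q => Real.log (τ i q) - Real.log (π q)
    · rw [Finset.sum_congr rfl fun z _ => Finset.mul_sum _ _ _, Finset.sum_comm]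
      exact Finset.sum_congr rfl fun p hp =>
        sum_prod_mul_apply₂ hτsum (Finset.mem_filter.1 hp).2.ne
          fun q l => Real.log (edgeProb (γ q l) (y p.1 p.2))
  · rw [← Finset.sum_mul, sum_prod_eq_one hτsum, one_mul]

/-- Unnormalized mean-field update of the weight of group `q` for node `i`. -/
noncomputable def meanFieldWeight {n Q : ℕ} (π : Fin Q → ℝ) (γ : Fin Q → Fin Q → ℝ)
    (y : Fin n → Fin n → Bool) (τ : Fin n → Fin Q → ℝ) (i : Fin n) (q : Fin Q) : ℝ :=
  π q * ∏ j ∈ Finset.univ.erase i, ∏ l : Fin Q, (edgeProb (γ q l) (y i j)) ^ (τ j l)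

theorem meanFieldWeight_pos {n Q : ℕ} {π : Fin Q → ℝ} (hπ : ∀ q, 0 < π q)
    {γ : Fin Q → Fin Q → ℝ} (hγ : ∀ q l, γ q l ∈ Set.Ioo (0 : ℝ) 1)
    (y : Fin n → Fin n → Bool) (τ : Fin n → Fin Q → ℝ) (i : Fin n) (q : Fin Q) :
    0 < meanFieldWeight π γ y τ i q :=
  mul_pos (hπ q) (Finset.prod_pos fun _ _ => Finset.prod_pos fun _ _ =>
    Real.rpow_pos_of_pos (edgeProb_pos (hγ _ _) _) _)

theorem log_meanFieldWeight {n Q : ℕ} {π : Fin Q → ℝ} (hπ : ∀ q, 0 < π q)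
    {γ : Fin Q → Fin Q → ℝ} (hγ : ∀ q l, γ q l ∈ Set.Ioo (0 : ℝ) 1)
    (y : Fin n → Fin n → Bool) (τ : Fin n → Fin Q → ℝ) (i : Fin n) (q : Fin Q) :
    Real.log (meanFieldWeight π γ y τ i q) = Real.log (π q)
      + ∑ j ∈ Finset.univ.erase i, ∑ l, τ j l * Real.log (edgeProb (γ q l) (y i j)) := by
  have h (j : Fin n) (l : Fin Q) : 0 < edgeProb (γ q l) (y i j) ^ τ j l :=
    Real.rpow_pos_of_pos (edgeProb_pos (hγ _ _) _) _
  rw [meanFieldWeight, Real.log_mul (hπ q).ne'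
      (Finset.prod_pos fun _ _ => Finset.prod_pos fun _ _ => h _ _).ne',
    Real.log_prod fun _ _ => (Finset.prod_pos fun _ _ => h _ _).ne']
  congr 1
  refine Finset.sum_congr rfl fun j _ => ?_
  rw [Real.log_prod fun _ _ => (h _ _).ne']
  exact Finset.sum_congr rfl fun l _ => Real.log_rpow (edgeProb_pos (hγ _ _) _) _

/-- As a function of the `i`-th row only, the mean-field divergence is, up to a constant, the
divergence of that row from the mean-field weights. -/
theorem exists_sum_prod_update_mul_log_eq {n Q : ℕ} {π : Fin Q → ℝ} (hπ : ∀ q, 0 < π q)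
    {γ : Fin Q → Fin Q → ℝ} (hγsym : ∀ q l, γ q l = γ l q)
    (hγ : ∀ q l, γ q l ∈ Set.Ioo (0 : ℝ) 1)
    {y : Fin n → Fin n → Bool} (hysym : ∀ i j, y i j = y j i) {N : ℝ} (hN : 0 < N)
    {τ : Fin n → Fin Q → ℝ} (hτpos : ∀ i q, 0 < τ i q) (hτsum : ∀ i, ∑ q, τ i q = 1)
    (i : Fin n) :
    ∃ K : ℝ, ∀ τ' : Fin n → Fin Q → ℝ, (∀ j, j ≠ i → τ' j = τ j) →
      (∀ q, 0 < τ' i q) → ∑ q, τ' i q = 1 →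
      ∑ z : Fin n → Fin Q, (∏ k, τ' k (z k)) *
          Real.log ((∏ k, τ' k (z k)) / (sbmJoint n Q π γ z y / N))
        = ∑ q, τ' i q * (Real.log (τ' i q) - Real.log (meanFieldWeight π γ y τ i q)) + K := by
  refine ⟨∑ j ∈ Finset.univ.erase i, ∑ q, τ j q * (Real.log (τ j q) - Real.log (π q))
    - ∑ p ∈ Finset.univ.filter
        (fun p : Fin n × Fin n => p.1 < p.2 ∧ p.1 ≠ i ∧ p.2 ≠ i),
        ∑ q, τ p.1 q * ∑ l, τ p.2 l * Real.log (edgeProb (γ q l) (y p.1 p.2))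
    + Real.log N, fun τ' hoff hpos hsum => ?_⟩
  have hpos' (j q) : 0 < τ' j q := by
    by_cases h : j = i
    · exact h ▸ hpos q
    · exact hoff j h ▸ hτpos j q
  have hsum' (j) : ∑ q, τ' j q = 1 := by
    by_cases h : j = i
    · exact h ▸ hsum
    · exact hoff j h ▸ hτsum j
  have hsymm (a b : Fin n) :
      ∑ q, τ' a q * ∑ l, τ' b l * Real.log (edgeProb (γ q l) (y a b))
        = ∑ q, τ' b q * ∑ l, τ' a l * Real.log (edgeProb (γ q l) (y b a)) := by
    simp only [Finset.mul_sum]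
    rw [Finset.sum_comm]
    refine Finset.sum_congr rfl fun q _ => Finset.sum_congr rfl fun l _ => ?_
    rw [hysym a b, hγsym l q]
    ring
  rw [sum_prod_mul_log_div_sbmJoint hπ hγ y hN hpos' hsum',
    sum_lt_eq_sum_erase_add
      (fun a b => ∑ q, τ' a q * ∑ l, τ' b l * Real.log (edgeProb (γ q l) (y a b))) hsymm i,
    ← Finset.add_sum_erase _ _ (Finset.mem_univ i)]
  have h1 : ∑ j ∈ Finset.univ.erase i, ∑ q, τ' j q * (Real.log (τ' j q) - Real.log (π q))
      = ∑ j ∈ Finset.univ.erase i, ∑ q, τ j q * (Real.log (τ j q) - Real.log (π q)) :=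
    Finset.sum_congr rfl fun j hj => by rw [hoff j (Finset.ne_of_mem_erase hj)]
  have h2 : ∑ p ∈ Finset.univ.filter
        (fun p : Fin n × Fin n => p.1 < p.2 ∧ p.1 ≠ i ∧ p.2 ≠ i),
        ∑ q, τ' p.1 q * ∑ l, τ' p.2 l * Real.log (edgeProb (γ q l) (y p.1 p.2))
      = ∑ p ∈ Finset.univ.filter
        (fun p : Fin n × Fin n => p.1 < p.2 ∧ p.1 ≠ i ∧ p.2 ≠ i),
        ∑ q, τ p.1 q * ∑ l, τ p.2 l * Real.log (edgeProb (γ q l) (y p.1 p.2)) :=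
    Finset.sum_congr rfl fun p hp => by
      have h := (Finset.mem_filter.1 hp).2
      rw [hoff _ h.2.1, hoff _ h.2.2]
  have h3 : ∑ j ∈ Finset.univ.erase i,
        ∑ q, τ' i q * ∑ l, τ' j l * Real.log (edgeProb (γ q l) (y i j))
      = ∑ q, τ' i q * ∑ j ∈ Finset.univ.erase i,
          ∑ l, τ j l * Real.log (edgeProb (γ q l) (y i j)) := by
    rw [Finset.sum_comm]
    refine Finset.sum_congr rfl fun q _ => ?_
    rw [Finset.mul_sum]
    exact Finset.sum_congr rfl fun j hj => by rw [hoff j (Finset.ne_of_mem_erase hj)]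
  have h4 : ∑ q, τ' i q * (Real.log (τ' i q) - Real.log (meanFieldWeight π γ y τ i q))
      = ∑ q, τ' i q * (Real.log (τ' i q) - Real.log (π q))
        - ∑ q, τ' i q * ∑ j ∈ Finset.univ.erase i,
          ∑ l, τ j l * Real.log (edgeProb (γ q l) (y i j)) := by
    rw [← Finset.sum_sub_distrib]
    refine Finset.sum_congr rfl fun q _ => ?_
    rw [log_meanFieldWeight hπ hγ]
    ring
  rw [h1, h2, h3, h4]
  ring

/-- **Mean-field variational fixed point for the SBM.**  If a positive
row-stochastic matrix `τ` minimizes the Kullback–Leibler divergence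
`KL(Q_τ ‖ P(Z = · | Y = y))` over all positive product (mean-field) distributions
`Q_τ'(z) = ∏ i, τ' i (z i)`, then `τ` satisfies the fixed-point relation
`τ_{iq} = C_i · π_q ∏_{j≠i} ∏_ℓ [γ_{qℓ}^{y_{ij}} (1-γ_{qℓ})^{1-y_{ij}}]^{τ_{jℓ}}`,
where `C_i > 0` normalizes each row. -/
theorem sbm_variational_fixed_point
    (n Q : ℕ) (hn : 2 ≤ n) (hQ : 0 < Q)
    (π : Fin Q → ℝ) (hπ : ∀ q, 0 < π q) (hπs : ∑ q, π q = 1)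
    (γ : Fin Q → Fin Q → ℝ) (hγsym : ∀ q l, γ q l = γ l q)
    (hγ : ∀ q l, γ q l ∈ Set.Ioo (0 : ℝ) 1)
    (y : Fin n → Fin n → Bool) (hysym : ∀ i j, y i j = y j i)
    (τ : Fin n → Fin Q → ℝ)
    (hτpos : ∀ i q, 0 < τ i q) (hτsum : ∀ i, ∑ q, τ i q = 1)
    (hmin : ∀ τ' : Fin n → Fin Q → ℝ,
      (∀ i q, 0 < τ' i q) → (∀ i, ∑ q, τ' i q = 1) →
      (∑ z : Fin n → Fin Q, (∏ i, τ i (z i)) *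
          Real.log ((∏ i, τ i (z i)) /
            (sbmJoint n Q π γ z y / ∑ z' : Fin n → Fin Q, sbmJoint n Q π γ z' y)))
        ≤ ∑ z : Fin n → Fin Q, (∏ i, τ' i (z i)) *
            Real.log ((∏ i, τ' i (z i)) /
              (sbmJoint n Q π γ z y / ∑ z' : Fin n → Fin Q, sbmJoint n Q π γ z' y))) :
    ∃ C : Fin n → ℝ, (∀ i, 0 < C i) ∧
      ∀ i q, τ i q
        = C i * π q *
            ∏ j ∈ Finset.univ.erase i, ∏ l : Fin Q,
              (edgeProb (γ q l) (y i j)) ^ (τ j l) := by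
  have : Nonempty (Fin Q) := ⟨⟨0, hQ⟩⟩
  have hN : 0 < ∑ z' : Fin n → Fin Q, sbmJoint n Q π γ z' y :=
    Finset.sum_pos (fun z _ => sbmJoint_pos hπ hγ z y) Finset.univ_nonempty
  have hw := meanFieldWeight_pos hπ hγ y τ
  have hW (i : Fin n) : 0 < ∑ q, meanFieldWeight π γ y τ i q :=
    Finset.sum_pos (fun q _ => hw i q) Finset.univ_nonempty
  refine ⟨fun i => (∑ q, meanFieldWeight π γ y τ i q)⁻¹, fun i => inv_pos.2 (hW i),
    fun i => ?_⟩
  set W := ∑ q, meanFieldWeight π γ y τ i q with hWdef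
  let s : Fin Q → ℝ := fun q => W⁻¹ * meanFieldWeight π γ y τ i q
  have hspos (q) : 0 < s q := mul_pos (inv_pos.2 (hW i)) (hw i q)
  have hssum : ∑ q, s q = 1 := by
    rw [← Finset.mul_sum, ← hWdef, inv_mul_cancel₀ (hW i).ne']
  have hslog (q) :
      Real.log (s q) = Real.log (meanFieldWeight π γ y τ i q) - Real.log W := by
    rw [Real.log_mul (inv_pos.2 (hW i)).ne' (hw i q).ne', Real.log_inv]
    ring
  obtain ⟨K, hK⟩ :=
    exists_sum_prod_update_mul_log_eq hπ hγsym hγ hysym hN hτpos hτsum i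
  have hle := hmin (Function.update τ i s)
    (fun j q => by
      by_cases h : j = i
      · subst h; simpa using hspos q
      · simpa [h] using hτpos j q)
    (fun j => by
      by_cases h : j = i
      · subst h; simpa using hssum
      · simpa [h] using hτsum j)
  rw [hK τ (fun _ _ => rfl) (hτpos i) (hτsum i),
    hK (Function.update τ i s) (fun j hj => Function.update_of_ne hj _ _)
      (by simpa using hspos) (by simpa using hssum), Function.update_self] at hle
  have hrow (r : Fin Q → ℝ) (hr : ∑ q, r q = 1) :
      ∑ q, r q * (Real.log (r q) - Real.log (meanFieldWeight π γ y τ i q))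
        = ∑ q, r q * (Real.log (r q) - Real.log (s q)) - Real.log W := by
    have hc : Real.log W = ∑ q, r q * Real.log W := by rw [← Finset.sum_mul, hr, one_mul]
    conv_rhs => rw [hc]
    rw [← Finset.sum_sub_distrib]
    refine Finset.sum_congr rfl fun q _ => ?_
    rw [hslog]
    ring
  rw [hrow _ (hτsum i), hrow _ hssum] at hle
  have heq : τ i = s := eq_of_sum_mul_log_sub_le (hτpos i) hspos
    ((hτsum i).trans hssum.symm) (by
      simp only [sub_self, mul_zero, Finset.sum_const_zero] at hle
      linarith)
  intro q
  rw [heq, mul_assoc]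
  rfl
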